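/- arXiv:1410.3098 — 2 statements merged into one kernel-verified Lean document; each statement's English description precedes it below -/
import Mathlib

section
/- Let G be the group of order 16 with presentation ⟨x, y, z | x⁴ = y² = z² = 1, [x,y] = 1, [y,z] = 1, z⁻¹xz = xy⟩. There exists a group automorphism φ of G with φ(x) = xyz, φ(y) = y, and φ(z) = x²yz. -/
namespace G16Pres

/-- Relators of ⟨x,y,z ∣ x⁴ = y² = z² = 1, [x,y] = 1, [y,z] = 1, z⁻¹xz = xy⟩. -/
def rels : Set (FreeGroup (Fin 3)) :=
  {FreeGroup.of 0 ^ 4, FreeGroup.of 1 ^ 2, FreeGroup.of 2 ^ 2,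
   FreeGroup.of 0 * FreeGroup.of 1 * (FreeGroup.of 0)⁻¹ * (FreeGroup.of 1)⁻¹,
   FreeGroup.of 1 * FreeGroup.of 2 * (FreeGroup.of 1)⁻¹ * (FreeGroup.of 2)⁻¹,
   ((FreeGroup.of 2)⁻¹ * FreeGroup.of 0 * FreeGroup.of 2) *
     (FreeGroup.of 0 * FreeGroup.of 1)⁻¹}

/-- The group G(16) with presentation
⟨x,y,z ∣ x⁴ = y² = z² = 1, [x,y] = [y,z] = 1, z⁻¹xz = xy⟩. -/
abbrev G : Type := PresentedGroup rels

def x : G := PresentedGroup.of 0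
def y : G := PresentedGroup.of 1
def z : G := PresentedGroup.of 2

theorem x_pow_four : x ^ 4 = 1 :=
  PresentedGroup.one_of_mem (rels := rels) (by simp [rels])

theorem y_sq : y ^ 2 = 1 :=
  PresentedGroup.one_of_mem (rels := rels) (by simp [rels])

theorem z_sq : z ^ 2 = 1 :=
  PresentedGroup.one_of_mem (rels := rels) (by simp [rels])

theorem commute_x_y : Commute x y := by
  have h : x * y * x⁻¹ * y⁻¹ = 1 :=
    PresentedGroup.one_of_mem (rels := rels)
      (x := FreeGroup.of 0 * FreeGroup.of 1 * (FreeGroup.of 0)⁻¹ * (FreeGroup.of 1)⁻¹)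
      (by simp [rels])
  exact mul_inv_eq_iff_eq_mul.mp (mul_inv_eq_one.mp h)

theorem commute_y_z : Commute y z := by
  have h : y * z * y⁻¹ * z⁻¹ = 1 :=
    PresentedGroup.one_of_mem (rels := rels)
      (x := FreeGroup.of 1 * FreeGroup.of 2 * (FreeGroup.of 1)⁻¹ * (FreeGroup.of 2)⁻¹)
      (by simp [rels])
  exact mul_inv_eq_iff_eq_mul.mp (mul_inv_eq_one.mp h)

theorem z_mul_x : z * x = x * y * z := by
  have h : z⁻¹ * x * z * (x * y)⁻¹ = 1 :=
    PresentedGroup.one_of_mem (rels := rels)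
      (x := (FreeGroup.of 2)⁻¹ * FreeGroup.of 0 * FreeGroup.of 2 *
        (FreeGroup.of 0 * FreeGroup.of 1)⁻¹)
      (by simp [rels])
  have hz : z⁻¹ = z := inv_eq_of_mul_eq_one_right (by rw [← sq, z_sq])
  rw [mul_inv_eq_one, hz] at h
  rw [← h, mul_assoc (z * x), ← sq, z_sq, mul_one]

/-- Triples of elements of a group satisfying the defining relations of `G` induce
homomorphisms out of `G`. -/
def liftHom {K : Type*} [Group K] (a b c : K) (ha : a ^ 4 = 1) (hb : b ^ 2 = 1) (hc : c ^ 2 = 1)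
    (hab : a * b = b * a) (hbc : b * c = c * b) (hac : a * c = c * (a * b)) : G →* K :=
  PresentedGroup.toGroup (f := ![a, b, c]) (rels := rels) (by
    rintro r (rfl | rfl | rfl | rfl | rfl | rfl)
    · simpa using ha
    · simpa using hb
    · simpa using hc
    · simp [hab]
    · simp [hbc]
    · simp [mul_assoc c⁻¹, hac])

section liftHom

variable {K : Type*} [Group K] {a b c : K} (ha : a ^ 4 = 1) (hb : b ^ 2 = 1) (hc : c ^ 2 = 1)
  (hab : a * b = b * a) (hbc : b * c = c * b) (hac : a * c = c * (a * b))

@[simp]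
theorem liftHom_x : liftHom a b c ha hb hc hab hbc hac x = a :=
  PresentedGroup.toGroup.of _

@[simp]
theorem liftHom_y : liftHom a b c ha hb hc hab hbc hac y = b :=
  PresentedGroup.toGroup.of _

@[simp]
theorem liftHom_z : liftHom a b c ha hb hc hab hbc hac z = c :=
  PresentedGroup.toGroup.of _

end liftHom

theorem hom_ext {K : Type*} [Group K] {f g : G →* K} (hx : f x = g x) (hy : f y = g y)
    (hz : f z = g z) : f = g := by
  refine PresentedGroup.ext fun i => ?_
  fin_cases i
  exacts [hx, hy, hz]

/-- The normal form `x ^ a * y ^ b * z ^ c`. -/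
def normalForm (a b c : ℕ) : G := x ^ a * y ^ b * z ^ c

theorem z_pow_mul_x_pow (c a : ℕ) : z ^ c * x ^ a = x ^ a * y ^ (c * a) * z ^ c := by
  have h (n : ℕ) : z ^ n * x = x * y ^ n * z ^ n := by
    induction n with
    | zero => simp
    | succ n ih =>
      rw [pow_succ, mul_assoc, z_mul_x, mul_assoc, commute_y_z.eq, ← mul_assoc, ← mul_assoc, ih,
        mul_assoc _ (z ^ n) z, mul_assoc _ (z ^ n * z) y, ← pow_succ,
        ← (commute_y_z.pow_right (n + 1)).eq, ← mul_assoc, mul_assoc x, ← pow_succ]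
  induction a with
  | zero => simp
  | succ a ih =>
    rw [pow_succ, ← mul_assoc, ih, mul_assoc, h, mul_assoc x, ← mul_assoc, mul_assoc (x ^ a),
      ← (commute_x_y.pow_right (c * a)).eq]
    simp only [mul_assoc, Nat.mul_succ, pow_add]

theorem normalForm_mul (a b c a₂ b₂ c₂ : ℕ) :
    normalForm a b c * normalForm a₂ b₂ c₂ = normalForm (a + a₂) (b + b₂ + c * a₂) (c + c₂) := by
  have hyx : y ^ b * x ^ a₂ = x ^ a₂ * y ^ b := ((commute_x_y.pow_pow a₂ b).eq).symm
  have hzy : z ^ c * y ^ b₂ = y ^ b₂ * z ^ c := ((commute_y_z.pow_pow b₂ c).eq).symm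
  calc normalForm a b c * normalForm a₂ b₂ c₂
      = x ^ a * y ^ b * (z ^ c * x ^ a₂) * y ^ b₂ * z ^ c₂ := by
        simp only [normalForm, mul_assoc]
    _ = x ^ a * (y ^ b * x ^ a₂) * y ^ (c * a₂) * (z ^ c * y ^ b₂) * z ^ c₂ := by
        rw [z_pow_mul_x_pow]; simp only [mul_assoc]
    _ = x ^ a * x ^ a₂ * (y ^ b * (y ^ (c * a₂) * y ^ b₂)) * (z ^ c * z ^ c₂) := by
        rw [hyx, hzy]; simp only [mul_assoc]
    _ = normalForm (a + a₂) (b + b₂ + c * a₂) (c + c₂) := by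
        rw [normalForm, ← pow_add, ← pow_add, ← pow_add, ← pow_add, add_assoc b, add_comm b₂]

theorem normalForm_congr {a b c a₂ b₂ c₂ : ℕ} (ha : a ≡ a₂ [MOD 4]) (hb : b ≡ b₂ [MOD 2])
    (hc : c ≡ c₂ [MOD 2]) : normalForm a b c = normalForm a₂ b₂ c₂ := by
  rw [normalForm, normalForm, pow_eq_pow_mod a x_pow_four, pow_eq_pow_mod b y_sq,
    pow_eq_pow_mod c z_sq, ha, hb, hc, ← pow_eq_pow_mod a₂ x_pow_four, ← pow_eq_pow_mod b₂ y_sq,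
    ← pow_eq_pow_mod c₂ z_sq]

/-- Exponent vectors `(a, b, c)` of normal forms `x ^ a * y ^ b * z ^ c`. -/
structure Exponents where
  a : ZMod 4
  b : ZMod 2
  c : ZMod 2

namespace Exponents

/-- Exponent vectors as a product type. -/
def equivProd : Exponents ≃ ZMod 4 × ZMod 2 × ZMod 2 where
  toFun u := (u.a, u.b, u.c)
  invFun u := ⟨u.1, u.2.1, u.2.2⟩
  left_inv _ := rfl
  right_inv _ := rfl

/-- Reduction of exponents of `x` modulo `2`. -/
abbrev red : ZMod 4 →+* ZMod 2 := ZMod.castHom (by decide) (ZMod 2)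

instance : Mul Exponents where
  mul u v := ⟨u.a + v.a, u.b + v.b + u.c * red v.a, u.c + v.c⟩

instance : One Exponents where
  one := ⟨0, 0, 0⟩

instance : Inv Exponents where
  inv u := ⟨-u.a, -u.b + u.c * red u.a, -u.c⟩

theorem mul_def (u v : Exponents) :
    u * v = ⟨u.a + v.a, u.b + v.b + u.c * red v.a, u.c + v.c⟩ := rfl

theorem one_def : (1 : Exponents) = ⟨0, 0, 0⟩ := rfl

theorem inv_def (u : Exponents) : u⁻¹ = ⟨-u.a, -u.b + u.c * red u.a, -u.c⟩ := rfl

instance : Group Exponents :=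
  Group.ofLeftAxioms
    (fun u v w => by
      simp only [mul_def, map_add, mk.injEq]
      refine ⟨by ring, by ring, by ring⟩)
    (fun u => by simp [mul_def, one_def])
    (fun u => by
      simp only [mul_def, one_def, inv_def, mk.injEq]
      refine ⟨by ring, by ring, by ring⟩)

theorem mk_a_pow (n : ℕ) : (⟨1, 0, 0⟩ : Exponents) ^ n = ⟨n, 0, 0⟩ := by
  induction n with
  | zero => simp [one_def]
  | succ n ih => simp [pow_succ, ih, mul_def]

theorem mk_b_pow (n : ℕ) : (⟨0, 1, 0⟩ : Exponents) ^ n = ⟨0, n, 0⟩ := by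
  induction n with
  | zero => simp [one_def]
  | succ n ih => simp [pow_succ, ih, mul_def]

theorem mk_c_pow (n : ℕ) : (⟨0, 0, 1⟩ : Exponents) ^ n = ⟨0, 0, n⟩ := by
  induction n with
  | zero => simp [one_def]
  | succ n ih => simp [pow_succ, ih, mul_def]

/-- The homomorphism sending an exponent vector to its normal form. -/
def toG : Exponents →* G :=
  MonoidHom.mk' (fun u => normalForm u.a.val u.b.val u.c.val) fun u v => by
    rw [normalForm_mul]
    refine normalForm_congr ?_ ?_ ?_ <;> rw [← ZMod.natCast_eq_natCast_iff] <;>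
      simp [mul_def]

theorem toG_apply (u : Exponents) : toG u = x ^ u.a.val * y ^ u.b.val * z ^ u.c.val := rfl

/-- The homomorphism reading off the exponents of the normal form. -/
def ofG : G →* Exponents :=
  liftHom ⟨1, 0, 0⟩ ⟨0, 1, 0⟩ ⟨0, 0, 1⟩
    (by rw [mk_a_pow]; rfl) (by rw [mk_b_pow]; rfl) (by rw [mk_c_pow]; rfl)
    (by simp [mul_def]) (by simp [mul_def])
    (by simp only [mul_def, mk.injEq]; decide)

/-- `G` is isomorphic to the group of exponent vectors. -/
def equivG : Exponents ≃* G :=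
  toG.toMulEquiv ofG
    (by
      ext1 u
      have hx : ofG x = ⟨1, 0, 0⟩ := liftHom_x ..
      have hy : ofG y = ⟨0, 1, 0⟩ := liftHom_y ..
      have hz : ofG z = ⟨0, 0, 1⟩ := liftHom_z ..
      simp [toG_apply, hx, hy, hz, mk_a_pow, mk_b_pow, mk_c_pow, mul_def])
    (hom_ext (by simp [ofG, toG_apply, ZMod.val_one'']) (by simp [ofG, toG_apply, ZMod.val_one''])
      (by simp [ofG, toG_apply, ZMod.val_one'']))

end Exponents

theorem card_G : Nat.card G = 16 := by
  rw [← Nat.card_congr Exponents.equivG.toEquiv, Nat.card_congr Exponents.equivProd]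
  simp

theorem x_eq_normalForm : x = normalForm 1 0 0 := by simp [normalForm]

theorem y_eq_normalForm : y = normalForm 0 1 0 := by simp [normalForm]

theorem z_eq_normalForm : z = normalForm 0 0 1 := by simp [normalForm]

theorem one_eq_normalForm : (1 : G) = normalForm 0 0 0 := by simp [normalForm]

/-- The endomorphism of `G` with `x ↦ x * y * z`, `y ↦ y`, `z ↦ x ^ 2 * y * z`. -/
def endo : G →* G :=
  liftHom (x * y * z) y (x ^ 2 * y * z)
    (by
      simp only [x_eq_normalForm, y_eq_normalForm, z_eq_normalForm, one_eq_normalForm, pow_succ,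
        pow_zero, normalForm_mul]
      exact normalForm_congr (by decide) (by decide) (by decide))
    y_sq
    (by
      simp only [x_eq_normalForm, y_eq_normalForm, z_eq_normalForm, one_eq_normalForm, pow_succ,
        pow_zero, normalForm_mul]
      exact normalForm_congr (by decide) (by decide) (by decide))
    (by simp only [x_eq_normalForm, y_eq_normalForm, z_eq_normalForm, normalForm_mul])
    (by simp only [x_eq_normalForm, y_eq_normalForm, z_eq_normalForm, pow_two, normalForm_mul])
    (by simp only [x_eq_normalForm, y_eq_normalForm, z_eq_normalForm, pow_two, normalForm_mul])

theorem endo_x : endo x = x * y * z := liftHom_x ..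

theorem endo_y : endo y = y := liftHom_y ..

theorem endo_z : endo z = x ^ 2 * y * z := liftHom_z ..

theorem endo_iterate_four : endo.comp (endo.comp (endo.comp endo)) = MonoidHom.id G := by
  refine hom_ext ?_ ?_ ?_ <;>
    simp only [MonoidHom.comp_apply, MonoidHom.id_apply, endo_x, endo_y, endo_z, map_mul, map_pow]
  · simp only [x_eq_normalForm, y_eq_normalForm, z_eq_normalForm, one_eq_normalForm, pow_succ,
      pow_zero, normalForm_mul]
    exact normalForm_congr (by decide) (by decide) (by decide)
  · simp only [x_eq_normalForm, y_eq_normalForm, z_eq_normalForm, one_eq_normalForm, pow_succ,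
      pow_zero, normalForm_mul]
    exact normalForm_congr (by decide) (by decide) (by decide)

end G16Pres

open G16Pres in
/-- The group G(16) of order 16 has an automorphism φ with φ(x) = xyz, φ(y) = y,
φ(z) = x²yz. -/
theorem G16_automorphism :
    Nat.card G = 16 ∧
    ∃ φ : G ≃* G, φ x = x * y * z ∧ φ y = y ∧ φ z = x ^ 2 * y * z :=
  ⟨card_G, endo.toMulEquiv (endo.comp (endo.comp endo)) endo_iterate_four endo_iterate_four,
    endo_x, endo_y, endo_z⟩
end

section
/- In the group S₄ × ℤ/2 = Equiv.Perm (Fin 4) × ZMod 2, each of the six elements ((12)(34), 1̄), ((12), 1̄), ((34), 1̄), ((14)(23), 1̄), ((23), 1̄), ((14), 1̄) has order 2, their product in this order equals the identity, and they generate S₄ × ℤ/2. (These data realize the ramification type (2⁶) of the covering C₂ → ℙ¹ with Galois group S₄ × ℤ/2.) -/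
namespace S4Z2

abbrev G : Type := Equiv.Perm (Fin 4) × Multiplicative (ZMod 2)

/-- ((12)(34), 1̄), permutations on {1,2,3,4} realized on Fin 4 = {0,1,2,3}. -/
def g₁ : G := (c[0, 1] * c[2, 3], Multiplicative.ofAdd 1)
/-- ((12), 1̄). -/
def g₂ : G := (c[0, 1], Multiplicative.ofAdd 1)
/-- ((34), 1̄). -/
def g₃ : G := (c[2, 3], Multiplicative.ofAdd 1)
/-- ((14)(23), 1̄). -/
def g₄ : G := (c[0, 3] * c[1, 2], Multiplicative.ofAdd 1)
/-- ((23), 1̄). -/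
def g₅ : G := (c[1, 2], Multiplicative.ofAdd 1)
/-- ((14), 1̄). -/
def g₆ : G := (c[0, 3], Multiplicative.ofAdd 1)

end S4Z2

/-- A subgroup of `Equiv.Perm (Fin (n + 1))` containing all adjacent transpositions is everything. -/
theorem Subgroup.eq_top_of_swap_castSucc_succ_mem {n : ℕ} (H : Subgroup (Equiv.Perm (Fin (n + 1))))
    (h : ∀ i : Fin n, Equiv.swap i.castSucc i.succ ∈ H) : H = ⊤ := by
  have hle : Submonoid.closure (Set.range fun i : Fin n ↦ Equiv.swap i.castSucc i.succ) ≤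
      H.toSubmonoid := Submonoid.closure_le.2 (Set.range_subset_iff.2 h)
  rw [Equiv.Perm.mclosure_swap_castSucc_succ] at hle
  exact top_le_iff.1 fun σ _ ↦ hle (Submonoid.mem_top σ)

open S4Z2 in
/-- The tuple (((12)(34),1̄), ((12),1̄), ((34),1̄), ((14)(23),1̄), ((23),1̄), ((14),1̄))
of elements of S₄ × ℤ/2 consists of elements of order 2, has product 1 in this order,
and generates S₄ × ℤ/2: it realizes the ramification type (2⁶) of the covering
C₂ → ℙ¹ with Galois group S₄ × ℤ/2. -/
theorem S4Z2_ramification_data_C2 :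
    orderOf g₁ = 2 ∧ orderOf g₂ = 2 ∧ orderOf g₃ = 2 ∧
    orderOf g₄ = 2 ∧ orderOf g₅ = 2 ∧ orderOf g₆ = 2 ∧
    g₁ * g₂ * g₃ * g₄ * g₅ * g₆ = 1 ∧
    Subgroup.closure {g₁, g₂, g₃, g₄, g₅, g₆} = (⊤ : Subgroup G) := by
  refine ⟨orderOf_eq_prime (by decide) (by decide), orderOf_eq_prime (by decide) (by decide),
    orderOf_eq_prime (by decide) (by decide), orderOf_eq_prime (by decide) (by decide),
    orderOf_eq_prime (by decide) (by decide), orderOf_eq_prime (by decide) (by decide),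
    by decide, ?_⟩
  set H : Subgroup G := Subgroup.closure {g₁, g₂, g₃, g₄, g₅, g₆}
  have h₁ : g₁ ∈ H := Subgroup.subset_closure (by simp)
  have h₂ : g₂ ∈ H := Subgroup.subset_closure (by simp)
  have h₃ : g₃ ∈ H := Subgroup.subset_closure (by simp)
  have h₅ : g₅ ∈ H := Subgroup.subset_closure (by simp)
  -- The product `g₁ * g₂ * g₃` is the generator of the factor `ℤ/2`.
  have hz : g₁ * g₂ * g₃ ∈ H := H.mul_mem (H.mul_mem h₁ h₂) h₃
  have hperm : H.comap (MonoidHom.inl _ _) = ⊤ := by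
    refine Subgroup.eq_top_of_swap_castSucc_succ_mem _ fun i ↦ Subgroup.mem_comap.2 ?_
    fin_cases i
    · convert H.mul_mem hz h₂ using 1
      decide
    · convert H.mul_mem hz h₅ using 1
      decide
    · convert H.mul_mem hz h₃ using 1
      decide
  have hinl (σ : Equiv.Perm (Fin 4)) : ((σ, 1) : G) ∈ H :=
    Subgroup.mem_comap.1 (hperm ▸ Subgroup.mem_top σ)
  have hinr (z : Multiplicative (ZMod 2)) : ((1, z) : G) ∈ H := by
    have hcases : ((1, z) : G) = 1 ∨ ((1, z) : G) = g₁ * g₂ * g₃ := by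
      revert z
      decide
    rcases hcases with h | h <;> rw [h]
    exacts [H.one_mem, hz]
  refine top_le_iff.1 fun ⟨σ, z⟩ _ ↦ ?_
  simpa using H.mul_mem (hinl σ) (hinr z)
end
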